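/- Let G be a finite connected loopless multigraph. Then the sandpile group Jac(G) is a finite abelian group whose order equals the number of spanning trees of G. -/

import Mathlib

attribute [local instance 10] Classical.propDecidable

/-- A finite multigraph, presented by darts (oriented edges): `rev` is the
fixed-point-free involution exchanging the two darts of each edge, and
`head d` is the vertex the dart `d` points to. -/
structure Multigraph where
  V : Type
  D : Type
  fV : Fintype V
  dV : DecidableEq V
  fD : Fintype D
  dD : DecidableEq D
  rev : D → D
  rev_invol : Function.Involutive rev
  rev_ne : ∀ d : D, rev d ≠ d
  head : D → V

attribute [instance] Multigraph.fV Multigraph.dV Multigraph.fD Multigraph.dD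

namespace Multigraph

variable (G : Multigraph)

/-- The tail (starting vertex) of a dart. -/
def tail (d : G.D) : G.V := G.head (G.rev d)

/-- `G` is loopless: no edge has equal endpoints. -/
def Loopless : Prop := ∀ d : G.D, G.head d ≠ G.tail d

/-- One-step adjacency between vertices. -/
def Adj (u v : G.V) : Prop := ∃ d : G.D, G.tail d = u ∧ G.head d = v

/-- `G` is connected. -/
def Connected : Prop := ∀ u v : G.V, Relation.ReflTransGen G.Adj u v

/-- The degree of a vertex: the number of darts with tail `v`. -/
def degree (v : G.V) : ℕ := (Finset.univ.filter fun d : G.D => G.tail d = v).card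

/-- The number of edges joining `v` to `w`. -/
def mul (v w : G.V) : ℕ :=
  (Finset.univ.filter fun d : G.D => G.tail d = v ∧ G.head d = w).card

/-! ### Divisors and the sandpile group -/

/-- The total degree homomorphism on divisors. -/
def degHom : (G.V → ℤ) →+ ℤ where
  toFun x := ∑ v, x v
  map_zero' := by simp
  map_add' x y := by simp [Finset.sum_add_distrib]

/-- Degree-zero divisors. -/
def Div0 : AddSubgroup (G.V → ℤ) := G.degHom.ker

/-- The principal divisor of a lending move at `v`: `v` loses `deg v` chips and
each other vertex `w` gains `n(v,w)` chips. -/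
def prin (v : G.V) : G.V → ℤ :=
  fun w => if w = v then -(G.degree v : ℤ) else (G.mul v w : ℤ)

/-- The subgroup of `ℤV` generated by all lending moves. -/
def Prin : AddSubgroup (G.V → ℤ) := AddSubgroup.closure (Set.range G.prin)

/-- Two divisors are linearly equivalent when they differ by a sequence of
lending moves. -/
def LinEquiv (D D' : G.V → ℤ) : Prop := D' - D ∈ G.Prin

/-- The sandpile group (Jacobian) of `G`: degree-zero divisors modulo
linear equivalence. -/
def Jac := G.Div0 ⧸ (G.Prin.addSubgroupOf G.Div0)

instance : AddCommGroup G.Jac :=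
  inferInstanceAs (AddCommGroup (G.Div0 ⧸ (G.Prin.addSubgroupOf G.Div0)))

/-- The divisor class of a degree-zero divisor in the sandpile group. -/
def divClass (D : G.Div0) : G.Jac := QuotientAddGroup.mk D

/-- The divisor `a - b` for vertices `a`, `b`. -/
def unitDivFun (a b : G.V) : G.V → ℤ :=
  fun w => (if w = a then 1 else 0) - (if w = b then 1 else 0)

lemma unitDivFun_mem (a b : G.V) : G.unitDivFun a b ∈ G.Div0 := by
  simp [Div0, degHom, AddMonoidHom.mem_ker, unitDivFun, Finset.sum_sub_distrib]

/-- The divisor `a - b` as a degree-zero divisor. -/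
def unitDiv (a b : G.V) : G.Div0 := ⟨G.unitDivFun a b, G.unitDivFun_mem a b⟩

/-- The class `[a - b] ∈ Jac(G)`. -/
def unitClass (a b : G.V) : G.Jac := G.divClass (G.unitDiv a b)

/-- The boundary of a dart: `∂ d = [d⁺ - d⁻] ∈ Jac(G)`. -/
def dartBoundary (d : G.D) : G.Jac := G.unitClass (G.head d) (G.tail d)

/-! ### The group ℤE of formal sums of oriented edges -/

/-- `ℤE`: functions on darts that are antisymmetric under reversal;
this is the free abelian group on the oriented edges, with `-e` identified
with the oppositely oriented edge. -/
def EdgeGroup : AddSubgroup (G.D → ℤ) where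
  carrier := {x | ∀ d, x (G.rev d) = -x d}
  add_mem' := by
    intro a b ha hb d
    simp only [Pi.add_apply, ha d, hb d]
    ring
  zero_mem' := by intro d; simp
  neg_mem' := by
    intro a ha d
    simp only [Pi.neg_apply, ha d]

/-- The element of `ℤE` corresponding to a single oriented edge (dart). -/
def dartVec (d : G.D) : G.D → ℤ :=
  fun d' => if d' = d then 1 else if d' = G.rev d then -1 else 0

lemma dartVec_mem (d : G.D) : G.dartVec d ∈ G.EdgeGroup := by
  have hinj := G.rev_invol.injective
  intro d'
  unfold dartVec
  rcases eq_or_ne d' d with rfl | h1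
  · simp [G.rev_ne d']
  · rcases eq_or_ne d' (G.rev d) with rfl | h2
    · simp [G.rev_invol d, G.rev_ne d]
    · have h3 : G.rev d' ≠ d := fun h => h2 (by rw [← h, G.rev_invol])
      have h4 : G.rev d' ≠ G.rev d := fun h => h1 (hinj h)
      simp [h1, h2, h3, h4]

/-- The vector of a list of darts (e.g. of a directed cycle). -/
def listVec (l : List G.D) : G.D → ℤ := (l.map G.dartVec).sum

/-- `l` is a directed cycle: a nonempty closed walk of darts through
pairwise distinct vertices. -/
def IsDirCycle (l : List G.D) : Prop :=
  l ≠ [] ∧ l.Chain' (fun a b => G.head a = G.tail b) ∧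
    (∀ a ∈ l.getLast?, ∀ b ∈ l.head?, G.head a = G.tail b) ∧
    (l.map G.tail).Nodup

/-- The integral cycle space `𝒞 ⊆ ℤE`. -/
def CycleSpace : AddSubgroup (G.D → ℤ) :=
  AddSubgroup.closure {x | ∃ l : List G.D, G.IsDirCycle l ∧ x = G.listVec l}

/-- The cut determined by a set `U` of vertices, directed out of `U`. -/
def cutVec (U : Finset G.V) : G.D → ℤ := fun d =>
  if G.tail d ∈ U ∧ G.head d ∉ U then 1
  else if G.head d ∈ U ∧ G.tail d ∉ U then -1 else 0

/-- The integral cut space `𝒞* ⊆ ℤE`. -/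
def CutSpace : AddSubgroup (G.D → ℤ) :=
  AddSubgroup.closure (Set.range G.cutVec)

/-- `ℰ(G) = ℤE / (𝒞 + 𝒞*)`. -/
def EGroup :=
  G.EdgeGroup ⧸ ((G.CycleSpace ⊔ G.CutSpace).addSubgroupOf G.EdgeGroup)

instance : AddCommGroup G.EGroup :=
  inferInstanceAs
    (AddCommGroup (G.EdgeGroup ⧸ ((G.CycleSpace ⊔ G.CutSpace).addSubgroupOf G.EdgeGroup)))

/-- The class of an oriented edge in `ℰ(G)`. -/
def eClass (d : G.D) : G.EGroup :=
  QuotientAddGroup.mk ⟨G.dartVec d, G.dartVec_mem d⟩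

/-- The boundary map `ℤE → ℤV`, sending an oriented edge `e` to `e⁺ - e⁻`
(when restricted to `ℤE ⊆ (D → ℤ)`). -/
def bMap : (G.D → ℤ) →+ (G.V → ℤ) where
  toFun x := fun v => ∑ d ∈ Finset.univ.filter (fun d => G.head d = v), x d
  map_zero' := by funext v; simp
  map_add' x y := by funext v; simp [Finset.sum_add_distrib]

/-! ### Spanning trees -/

/-- Adjacency using only darts in `T`. -/
def treeAdj (T : Finset G.D) (u v : G.V) : Prop :=
  ∃ d ∈ T, G.tail d = u ∧ G.head d = v

/-- `T` (a reversal-closed set of darts) is a spanning tree: it is connected,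
meets every vertex, and has exactly `|V| - 1` edges (hence is acyclic). -/
def IsSpanningTree (T : Finset G.D) : Prop :=
  (∀ d ∈ T, G.rev d ∈ T) ∧
    (∀ u v : G.V, Relation.ReflTransGen (G.treeAdj T) u v) ∧
    T.card = 2 * (Fintype.card G.V - 1)

/-- The reversal involution as a permutation of darts. -/
def revPerm : Equiv.Perm G.D := Function.Involutive.toPerm G.rev G.rev_invol

end Multigraph

/-- A ribbon graph: a multigraph together with, at each vertex, a cyclic
ordering of the incident edges (darts).  `next d` is the dart following `d`
in the cyclic order at the tail of `d`. -/
structure RibbonGraph extends Multigraph where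
  next : Equiv.Perm toMultigraph.D
  next_tail : ∀ d : toMultigraph.D, toMultigraph.tail (next d) = toMultigraph.tail d
  next_cyclic : ∀ d d' : toMultigraph.D,
    toMultigraph.tail d = toMultigraph.tail d' → next.SameCycle d d'

namespace RibbonGraph

variable (G : RibbonGraph)

/-- The face permutation of a ribbon graph; its orbits are the faces of the
associated surface embedding (the orbit of a dart `d` is the face to the left
of `d`, when the cyclic orders are taken clockwise). -/
def facePerm : Equiv.Perm G.D := G.next * G.revPerm

/-- Darts lie in the same face when they are in the same orbit of the face
permutation. -/
def faceSetoid : Setoid G.D :=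
  ⟨G.facePerm.SameCycle,
    ⟨fun x => Equiv.Perm.SameCycle.refl _ x, fun h => h.symm, fun h h' => h.trans h'⟩⟩

/-- The faces of the surface embedding determined by the ribbon structure. -/
def Faces := Quotient G.faceSetoid

instance : Fintype G.Faces :=
  @Quotient.fintype _ _ G.faceSetoid
    (fun a b => inferInstanceAs (Decidable (G.facePerm.SameCycle a b)))

/-- The face to the left of a dart. -/
def leftFace (d : G.D) : G.Faces := Quotient.mk G.faceSetoid d

/-- The face to the right of a dart. -/
def rightFace (d : G.D) : G.Faces := G.leftFace (G.rev d)

/-- `G` is a planar ribbon graph: the surface it embeds in has genus `0`,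
i.e. Euler's formula `|V| - |E| + |F| = 2` holds. -/
def IsPlanar : Prop :=
  Fintype.card G.V + Fintype.card G.Faces = Fintype.card G.D / 2 + 2

/-! ### Rotor-routing -/

/-- A rotor configuration with basepoint `q`: a choice, for each vertex
`v ≠ q`, of a dart with tail `v`. -/
def RotorConfig (q : G.V) :=
  {ρ : (v : G.V) → v ≠ q → G.D // ∀ (v : G.V) (h : v ≠ q), G.tail (ρ v h) = v}

/-- Firing the vertex `v ≠ q` in a state (chip configuration, rotor
configuration): the rotor at `v` advances to the next dart in the cyclic
order at `v`, and one chip moves from `v` to the head of the new rotor. -/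
def fire (q : G.V) (v : G.V) (hv : v ≠ q) (s : (G.V → ℤ) × G.RotorConfig q) :
    (G.V → ℤ) × G.RotorConfig q :=
  ((fun w => s.1 w - (if w = v then 1 else 0) +
      (if w = G.head (G.next (s.2.1 v hv)) then 1 else 0)),
   ⟨fun u hu => if u = v then G.next (s.2.1 v hv) else s.2.1 u hu, by
      intro u hu
      by_cases h : u = v
      · simp only [if_pos h]
        rw [G.next_tail, s.2.2 v hv, h]
      · simp only [if_neg h]
        exact s.2.2 u hu⟩)

/-- A single legal rotor-routing step: fire some vertex `v ≠ q` carrying at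
least one chip. -/
def Step (q : G.V) (s s' : (G.V → ℤ) × G.RotorConfig q) : Prop :=
  ∃ (v : G.V) (hv : v ≠ q), 1 ≤ s.1 v ∧ s' = G.fire q v hv s

/-- A state is terminal when no vertex other than `q` can be fired. -/
def Terminal (q : G.V) (s : (G.V → ℤ) × G.RotorConfig q) : Prop :=
  ∀ v : G.V, v ≠ q → s.1 v ≤ 0

/-- `ρ` is the rotor configuration obtained by orienting the spanning tree
`T` towards the root `q`: every rotor is a dart of `T`, and following the
rotors from any vertex leads to `q`. -/
def TowardRoot (q : G.V) (T : Finset G.D) (ρ : G.RotorConfig q) : Prop :=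
  ∀ (v : G.V) (h : v ≠ q), ρ.1 v h ∈ T ∧
    Relation.ReflTransGen (fun a b => ∃ ha : a ≠ q, G.head (ρ.1 a ha) = b) v q

/-- The rotor-routing process started from a representative of `x` that is
nonnegative away from `q` and from the rotor configuration of `T` oriented
towards `q` terminates at the rotor configuration of `T'` oriented towards
`q`. -/
def ActsTo (q : G.V) (x : G.Jac) (T T' : Finset G.D) : Prop :=
  ∃ D : G.Div0, G.divClass D = x ∧ (∀ v : G.V, v ≠ q → 0 ≤ (D : G.V → ℤ) v) ∧
    ∃ (ρ ρ' : G.RotorConfig q) (c' : G.V → ℤ),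
      G.TowardRoot q T ρ ∧ G.TowardRoot q T' ρ' ∧
      Relation.ReflTransGen (G.Step q) ((D : G.V → ℤ), ρ) (c', ρ') ∧
      G.Terminal q (c', ρ')

/-- The rotor-routing action of the sandpile group element `x` on the
spanning tree `T`, with basepoint `q`. -/
noncomputable def rotorAction (q : G.V) (x : G.Jac) (T : Finset G.D) :
    Finset G.D :=
  if h : ∃ T' : Finset G.D, G.IsSpanningTree T' ∧ G.ActsTo q x T T' then
    h.choose
  else T

/-! ### Angles -/

/-- The angle `∠ᵘ(d, d')` between two darts with the same tail `u`:
if `d = e₀, e₁, …, e_k = d'` are the consecutive darts in the cyclic order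
at `u`, the angle is `∑_{i=1}^{k} ∂ eᵢ ∈ Jac(G)`. -/
noncomputable def dartAngle (d d' : G.D) : G.Jac :=
  if h : ∃ k : ℕ, (⇑G.next)^[k] d = d' then
    ∑ i ∈ Finset.range (Nat.find h), G.dartBoundary ((⇑G.next)^[i + 1] d)
  else 0

/-- The angle `∠_v(T, T')` between two spanning trees `T, T'` based at `v`:
the sum over all vertices `u ≠ v` of the angles between the rotors of `T`
and of `T'` at `u` (both oriented towards `v`). -/
noncomputable def treeAngle (v : G.V) (T T' : Finset G.D) : G.Jac :=
  if h : ∃ p : G.RotorConfig v × G.RotorConfig v,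
      G.TowardRoot v T p.1 ∧ G.TowardRoot v T' p.2 then
    ∑ u : G.V,
      if hu : u = v then 0
      else G.dartAngle (h.choose.1.1 u hu) (h.choose.2.1 u hu)
  else 0


/-! ### The planar dual ribbon graph -/

/-- The dual ribbon graph `G*` of a ribbon graph `G`: its vertices are the
faces of `G`, its darts are the darts of `G`, where the dart `d`, viewed in
the dual, crosses `d` from the face after `d` (its right, its dual tail) to
the face before `d` (its left, its dual head), and the cyclic orders at the
faces are the counter-clockwise ones. -/
noncomputable def dual : RibbonGraph where
  V := G.Faces
  D := G.D
  fV := inferInstance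
  dV := Classical.decEq _
  fD := G.fD
  dD := G.dD
  rev := G.rev
  rev_invol := G.rev_invol
  rev_ne := G.rev_ne
  head := fun d => G.leftFace d
  next := G.revPerm * G.facePerm * G.revPerm
  next_tail := by
    intro d
    show G.leftFace (G.rev (G.rev (G.facePerm (G.rev d)))) = G.leftFace (G.rev d)
    rw [G.rev_invol]
    exact Quotient.sound ⟨-1, by simp⟩
  next_cyclic := by
    intro d d' h
    have h1 : G.facePerm.SameCycle (G.rev d) (G.rev d') := Quotient.exact h
    have h2 := h1.conj (g := G.revPerm)
    have hR : G.revPerm⁻¹ = G.revPerm := by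
      rw [Equiv.Perm.inv_def]
      exact Function.Involutive.toPerm_symm G.rev_invol
    rw [hR] at h2
    have e1 : G.revPerm (G.rev d) = d := G.rev_invol d
    have e2 : G.revPerm (G.rev d') = d' := G.rev_invol d'
    rw [e1, e2] at h2
    exact h2


end RibbonGraph

namespace Multigraph

/-! ### Relations leading to a root -/

/-- If every element is related to `q` by a chain, there is a height function that can be
strictly decreased along the relation away from `q`. -/
theorem exists_height {α : Type*} (r : α → α → Prop) (q : α)
    (hr : ∀ v, Relation.ReflTransGen r v q) :
    ∃ h : α → ℕ, ∀ v, v ≠ q → ∃ w, r v w ∧ h w < h v := by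
  let reach : ℕ → α → Prop := fun n =>
    Nat.rec (motive := fun _ => α → Prop) (fun v => v = q) (fun _ P v => ∃ w, r v w ∧ P w) n
  have hex : ∀ v, ∃ n, reach n v := by
    intro v
    induction hr v using Relation.ReflTransGen.head_induction_on with
    | refl => exact ⟨0, rfl⟩
    | head hvw _ ih =>
      obtain ⟨n, hn⟩ := ih
      exact ⟨n + 1, _, hvw, hn⟩
  classical
  refine ⟨fun v => Nat.find (hex v), fun v hv => ?_⟩
  have hs : reach (Nat.find (hex v)) v := Nat.find_spec (hex v)
  rcases hk : Nat.find (hex v) with _ | m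
  · rw [hk] at hs
    exact absurd hs hv
  · rw [hk] at hs
    obtain ⟨w, hvw, hw⟩ := hs
    refine ⟨w, hvw, ?_⟩
    change Nat.find (hex w) < Nat.find (hex v)
    rw [hk]
    exact Nat.lt_succ_of_le (Nat.find_min' (hex w) hw)

variable (G : Multigraph)

/-! ### The reduced Laplacian -/

/-- The vector `e_v - e_{d⁺}` with the coordinate of the root `q` dropped. -/
def dartRow (q : G.V) (v : {v : G.V // v ≠ q}) (d : G.D) : {v : G.V // v ≠ q} → ℤ :=
  fun w => (if v = w then 1 else 0) - (if G.head d = w then 1 else 0)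

/-- The Laplacian of `G` with the row and column of the root `q` deleted. -/
def reducedLaplacian (q : G.V) : Matrix {v : G.V // v ≠ q} {v : G.V // v ≠ q} ℤ :=
  Matrix.of fun v w => -G.prin v w

theorem prin_eq_sum (hloop : G.Loopless) (v w : G.V) :
    G.prin v w = ∑ d : G.D, if G.tail d = v then
      (if G.head d = w then 1 else 0) - (if v = w then 1 else 0 : ℤ) else 0 := by
  rw [← Finset.sum_filter, Finset.sum_sub_distrib]
  unfold prin
  split_ifs with h h' h'
  · subst h
    have h0 : ∑ d ∈ Finset.univ.filter (fun d : G.D => G.tail d = w),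
        (if G.head d = w then 1 else 0 : ℤ) = 0 := by
      refine Finset.sum_eq_zero fun d hd => if_neg ?_
      rw [← (Finset.mem_filter.1 hd).2]
      exact hloop d
    rw [h0]
    simp [degree]
  · exact absurd h.symm h'
  · exact absurd h'.symm h
  · simp [mul, ← Finset.filter_filter, Finset.sum_boole]

theorem sum_prin_apply (hloop : G.Loopless) (w : G.V) : ∑ v, G.prin v w = 0 := by
  simp_rw [G.prin_eq_sum hloop]
  rw [Finset.sum_comm]
  simp only [Finset.sum_ite_eq, Finset.mem_univ, if_true]
  rw [Finset.sum_sub_distrib, sub_eq_zero]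
  exact Fintype.sum_equiv G.revPerm _ _ fun d => by
    simp [revPerm, tail, G.rev_invol d]

theorem prin_mem_Div0 (hloop : G.Loopless) (v : G.V) : G.prin v ∈ G.Div0 := by
  change ∑ w, G.prin v w = 0
  simp_rw [G.prin_eq_sum hloop]
  rw [Finset.sum_comm]
  refine Finset.sum_eq_zero fun d _ => ?_
  split_ifs <;> simp

theorem Prin_le_Div0 (hloop : G.Loopless) : G.Prin ≤ G.Div0 := by
  rw [Prin, AddSubgroup.closure_le]
  rintro _ ⟨v, rfl⟩
  exact G.prin_mem_Div0 hloop v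

/-- Forgetting the coordinate at the root `q`. -/
def dropRoot (q : G.V) : (G.V → ℤ) →+ ({v : G.V // v ≠ q} → ℤ) where
  toFun x v := x v
  map_zero' := rfl
  map_add' _ _ := rfl

theorem sum_eq_root_add (q : G.V) (x : G.V → ℤ) :
    ∑ v, x v = x q + ∑ v : {v : G.V // v ≠ q}, x v := by
  rw [← Finset.add_sum_erase _ _ (Finset.mem_univ q)]
  congr 1
  exact Finset.sum_subtype _ (by simp) _

theorem dropRoot_bijective (q : G.V) :
    Function.Bijective ((G.dropRoot q).comp G.Div0.subtype) := by
  constructor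
  · rw [injective_iff_map_eq_zero]
    rintro ⟨x, hx⟩ h
    have hx' : ∑ v, x v = 0 := hx
    have hn : ∀ v : {v : G.V // v ≠ q}, x v = 0 := fun v => congrFun h v
    rw [G.sum_eq_root_add q] at hx'
    simp only [hn, Finset.sum_const_zero, add_zero] at hx'
    ext v
    by_cases hv : v = q
    · subst hv; exact hx'
    · exact hn ⟨v, hv⟩
  · intro y
    refine ⟨⟨fun v => if hv : v = q then -∑ w, y w else y ⟨v, hv⟩, ?_⟩, ?_⟩
    · change ∑ v, _ = (0 : ℤ)
      rw [G.sum_eq_root_add q]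
      have : ∀ v : {v : G.V // v ≠ q}, (v : G.V) ≠ q := fun v => v.2
      simp [this]
    · ext v
      simp [dropRoot, v.2]

theorem map_dropRoot_Prin (hloop : G.Loopless) (q : G.V) :
    G.Prin.map (G.dropRoot q) =
      (LinearMap.range (G.reducedLaplacian q).vecMulLinear).toAddSubgroup := by
  have hrow : ∀ v : {v : G.V // v ≠ q},
      G.dropRoot q (G.prin v) = -(G.reducedLaplacian q).row v := by
    intro v; ext w; simp [dropRoot, reducedLaplacian]
  rw [range_vecMulLinear]
  apply le_antisymm
  · rw [Prin, AddMonoidHom.map_closure, AddSubgroup.closure_le]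
    rintro _ ⟨_, ⟨v, rfl⟩, rfl⟩
    have hn : ∀ v : {v : G.V // v ≠ q}, G.dropRoot q (G.prin v) ∈
        Submodule.span ℤ (Set.range (G.reducedLaplacian q).row) := fun v => by
      rw [hrow]
      exact neg_mem (Submodule.subset_span ⟨v, rfl⟩)
    by_cases hv : v = q
    · subst hv
      have h0 : G.dropRoot v (G.prin v) =
          -∑ w : {w : G.V // w ≠ v}, G.dropRoot v (G.prin w) := by
        ext u
        have := G.sum_prin_apply hloop u
        rw [G.sum_eq_root_add v (fun w => G.prin w u)] at this
        simpa [dropRoot] using eq_neg_of_add_eq_zero_left this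
      rw [h0]
      exact neg_mem (sum_mem fun w _ => hn w)
    · exact hn ⟨v, hv⟩
  · have : Submodule.span ℤ (Set.range (G.reducedLaplacian q).row) ≤
        AddSubgroup.toIntSubmodule (G.Prin.map (G.dropRoot q)) := by
      rw [Submodule.span_le]
      rintro _ ⟨v, rfl⟩
      refine ⟨-G.prin v, neg_mem (AddSubgroup.subset_closure ⟨v, rfl⟩), ?_⟩
      rw [map_neg, hrow, neg_neg]
    exact this

theorem card_Jac_eq_natAbs_det (hloop : G.Loopless) (q : G.V)
    (hdet : (G.reducedLaplacian q).det ≠ 0) :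
    Nat.card G.Jac = (G.reducedLaplacian q).det.natAbs := by
  let f := (G.reducedLaplacian q).vecMulLinear
  have hf : Function.Injective f := by
    rw [injective_iff_map_eq_zero]
    exact fun x hx => Matrix.eq_zero_of_vecMul_eq_zero hdet hx
  let e : G.Div0 ≃+ ({v : G.V // v ≠ q} → ℤ) :=
    AddEquiv.ofBijective _ (G.dropRoot_bijective q)
  have hmap : (G.Prin.addSubgroupOf G.Div0).map (e : G.Div0 →+ _) =
      (LinearMap.range f).toAddSubgroup := by
    have : (e : G.Div0 →+ _) = (G.dropRoot q).comp G.Div0.subtype := rfl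
    rw [this, ← AddSubgroup.map_map, AddSubgroup.addSubgroupOf_map_subtype,
      inf_eq_left.2 (G.Prin_le_Div0 hloop), G.map_dropRoot_Prin hloop q]
  have hcard := Submodule.natAbs_det_equiv (LinearMap.range f) (LinearEquiv.ofInjective f hf)
  have hcongr : Nat.card G.Jac = Nat.card (({v : G.V // v ≠ q} → ℤ) ⧸ LinearMap.range f) :=
    Nat.card_congr (QuotientAddGroup.congr _ _ e hmap).toEquiv
  rw [hcongr, ← hcard]
  congr 1
  have : (LinearMap.range f).subtype ∘ₗ AddMonoidHom.toIntLinearMap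
      ((LinearEquiv.ofInjective f hf : _ ≃ₗ[ℤ] _) : _ →+ LinearMap.range f) =
        Matrix.toLin' (G.reducedLaplacian q).transpose := by
    ext x w
    simp [f]
  rw [this, LinearMap.det_toLin', Matrix.det_transpose]

/-! ### Rotor choices and the determinant -/

/-- A choice `ρ` of darts at the vertices other than `q` leads to `q` when some height
function strictly decreases along it. -/
def LeadsTo (q : G.V) (ρ : {v : G.V // v ≠ q} → G.D) : Prop :=
  ∃ h : G.V → ℕ, ∀ v, h (G.head (ρ v)) < h v

/-- All choices, for each vertex other than `q`, of a dart leaving it. -/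
def dartChoices (q : G.V) : Finset ({v : G.V // v ≠ q} → G.D) :=
  Fintype.piFinset fun v => Finset.univ.filter fun d => G.tail d = v

theorem mem_dartChoices {q : G.V} {ρ : {v : G.V // v ≠ q} → G.D} :
    ρ ∈ G.dartChoices q ↔ ∀ v, G.tail (ρ v) = v := by
  simp [dartChoices]

theorem det_dartRow_of_leadsTo {q : G.V} {ρ : {v : G.V // v ≠ q} → G.D}
    (hρ : G.LeadsTo q ρ) : (Matrix.of fun v => G.dartRow q v (ρ v)).det = 1 := by
  obtain ⟨h, hh⟩ := hρ
  have hb : (Matrix.of fun v => G.dartRow q v (ρ v)).BlockTriangular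
      fun v => OrderDual.toDual (h v) := by
    intro v w hvw
    have hvw' : h v < h w := hvw
    have h1 : v ≠ w := by rintro rfl; exact hvw'.false
    have h2 : G.head (ρ v) ≠ w := fun he => by
      have := hh v
      rw [he] at this
      omega
    simp [dartRow, h1, h2]
  rw [hb.det]
  refine Finset.prod_eq_one fun a _ => ?_
  suffices (Matrix.of fun v => G.dartRow q v (ρ v)).toSquareBlock
      (fun v => OrderDual.toDual (h v)) a = 1 by rw [this, Matrix.det_one]
  ext v w
  have h2 : G.head (ρ v) ≠ (w : {v : G.V // v ≠ q}) := fun he => by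
    have h3 := hh v
    have h4 : h v = h w := OrderDual.toDual.injective (v.2.trans w.2.symm)
    rw [he, h4] at h3
    exact h3.false
  simp [Matrix.toSquareBlock_def, dartRow, h2, Matrix.one_apply, Subtype.ext_iff]

theorem det_dartRow_of_not_leadsTo {q : G.V} {ρ : {v : G.V // v ≠ q} → G.D}
    (hρ : ¬G.LeadsTo q ρ) : (Matrix.of fun v => G.dartRow q v (ρ v)).det = 0 := by
  let r : G.V → G.V → Prop := fun v w => ∃ hv : v ≠ q, G.head (ρ ⟨v, hv⟩) = w
  have hne : ∃ v, ¬Relation.ReflTransGen r v q := by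
    by_contra! hall
    obtain ⟨h, hh⟩ := exists_height r q hall
    refine hρ ⟨h, fun v => ?_⟩
    obtain ⟨w, ⟨_, rfl⟩, hw⟩ := hh v v.2
    exact hw
  obtain ⟨v₀, hv₀⟩ := hne
  have hv₀q : v₀ ≠ q := by rintro rfl; exact hv₀ .refl
  rw [← Matrix.exists_mulVec_eq_zero_iff]
  refine ⟨fun v => if Relation.ReflTransGen r v q then 0 else 1, fun h0 => ?_, ?_⟩
  · simpa [hv₀] using congrFun h0 ⟨v₀, hv₀q⟩
  · ext v
    have hstep : Relation.ReflTransGen r (G.head (ρ v)) q ↔ Relation.ReflTransGen r v q := by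
      refine ⟨fun h => .head ⟨v.2, rfl⟩ h, fun h => ?_⟩
      obtain h | ⟨w, ⟨_, rfl⟩, hw⟩ := h.cases_head
      · exact absurd h v.2
      · exact hw
    simp only [Matrix.mulVec, dotProduct, Matrix.of_apply, dartRow, sub_mul,
      Finset.sum_sub_distrib, ite_mul, one_mul, zero_mul, Finset.sum_ite_eq,
      Finset.mem_univ, if_true, Pi.zero_apply]
    by_cases hq : G.head (ρ v) = q
    · have h1 : Relation.ReflTransGen r v q := hstep.1 (hq ▸ .refl)
      rw [if_pos h1, Finset.sum_eq_zero, sub_zero]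
      intro w _
      rw [if_neg]
      rw [hq]
      exact w.2.symm
    · rw [Finset.sum_eq_single ⟨G.head (ρ v), hq⟩]
      · simp [hstep]
      · intro w _ hw
        rw [if_neg]
        exact fun h => hw (Subtype.ext h.symm)
      · simp

theorem det_reducedLaplacian (hloop : G.Loopless) (q : G.V) :
    (G.reducedLaplacian q).det =
      ((G.dartChoices q).filter fun ρ => G.LeadsTo q ρ).card := by
  have hL : G.reducedLaplacian q = fun v : {v : G.V // v ≠ q} =>
      ∑ d ∈ Finset.univ.filter (fun d => G.tail d = v), G.dartRow q v d := by
    ext v w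
    rw [Finset.sum_apply, Finset.sum_filter]
    simp only [reducedLaplacian, Matrix.of_apply, G.prin_eq_sum hloop, ← Finset.sum_neg_distrib]
    refine Finset.sum_congr rfl fun d _ => ?_
    split_ifs <;> simp_all [dartRow, Subtype.ext_iff]
  have hexp := (Matrix.detRowAlternating (R := ℤ)
    (n := {v : G.V // v ≠ q})).toMultilinearMap.map_sum_finset
      (fun v d => G.dartRow q v d) (fun v => Finset.univ.filter fun d => G.tail d = v)
  rw [hL]
  refine hexp.trans ?_
  rw [Finset.card_filter, Nat.cast_sum]
  refine Finset.sum_congr rfl fun ρ _ => ?_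
  split_ifs with h
  · exact_mod_cast G.det_dartRow_of_leadsTo h
  · exact_mod_cast G.det_dartRow_of_not_leadsTo h

/-! ### Spanning trees as dart choices leading to the root -/

/-- The reversal-closed set of darts spanned by a choice of darts. -/
def choiceDarts {q : G.V} (ρ : {v : G.V // v ≠ q} → G.D) : Finset G.D :=
  Finset.univ.image ρ ∪ Finset.univ.image fun v => G.rev (ρ v)

theorem mem_choiceDarts {q : G.V} {ρ : {v : G.V // v ≠ q} → G.D} {d : G.D} :
    d ∈ G.choiceDarts ρ ↔ (∃ v, ρ v = d) ∨ ∃ v, G.rev (ρ v) = d := by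
  simp [choiceDarts]

theorem head_rev (d : G.D) : G.head (G.rev d) = G.tail d := rfl

theorem tail_rev (d : G.D) : G.tail (G.rev d) = G.head d := by
  rw [tail, G.rev_invol]

variable {G}

theorem LeadsTo.ne_rev {q : G.V} {ρ : {v : G.V // v ≠ q} → G.D} (hρ : G.LeadsTo q ρ)
    (ht : ∀ v, G.tail (ρ v) = v) (v w : {v : G.V // v ≠ q}) : ρ v ≠ G.rev (ρ w) := by
  obtain ⟨h, hh⟩ := hρ
  intro he
  have h1 : G.head (ρ v) = w := by rw [he, head_rev, ht]
  have h2 : G.head (ρ w) = v := by rw [← tail_rev, ← he, ht]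
  have h3 := hh v
  have h4 := hh w
  rw [h1] at h3
  rw [h2] at h4
  exact h3.asymm h4

theorem card_choiceDarts {q : G.V} {ρ : {v : G.V // v ≠ q} → G.D} (hρ : G.LeadsTo q ρ)
    (ht : ∀ v, G.tail (ρ v) = v) :
    (G.choiceDarts ρ).card = 2 * (Fintype.card G.V - 1) := by
  have hinj : Function.Injective ρ := fun v w h => Subtype.ext (by rw [← ht v, ← ht w, h])
  have hdisj : Disjoint (Finset.univ.image ρ) (Finset.univ.image fun v => G.rev (ρ v)) := by
    rw [Finset.disjoint_left]
    simp only [Finset.mem_image, Finset.mem_univ, true_and]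
    rintro _ ⟨v, rfl⟩ ⟨w, hw⟩
    exact hρ.ne_rev ht v w hw.symm
  have hc : Fintype.card {v : G.V // v ≠ q} = Fintype.card G.V - 1 := by
    simp [Fintype.card_subtype_compl]
  rw [choiceDarts, Finset.card_union_of_disjoint hdisj,
    Finset.card_image_of_injective _ hinj,
    Finset.card_image_of_injective _ (f := fun v => G.rev (ρ v))
      (G.rev_invol.injective.comp hinj), Finset.card_univ, hc]
  omega

theorem isSpanningTree_choiceDarts {q : G.V} {ρ : {v : G.V // v ≠ q} → G.D}
    (hρ : G.LeadsTo q ρ) (ht : ∀ v, G.tail (ρ v) = v) : G.IsSpanningTree (G.choiceDarts ρ) := by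
  have hrev : ∀ d ∈ G.choiceDarts ρ, G.rev d ∈ G.choiceDarts ρ := by
    intro d hd
    rw [mem_choiceDarts] at hd ⊢
    rcases hd with ⟨v, rfl⟩ | ⟨v, rfl⟩
    · exact .inr ⟨v, rfl⟩
    · exact .inl ⟨v, (G.rev_invol _).symm⟩
  refine ⟨hrev, ?_, card_choiceDarts hρ ht⟩
  have hsymm : Std.Symm (G.treeAdj (G.choiceDarts ρ)) := by
    constructor
    rintro u v ⟨d, hd, rfl, rfl⟩
    exact ⟨G.rev d, hrev d hd, tail_rev G d, rfl⟩
  obtain ⟨h, hh⟩ := hρ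
  have hroot : ∀ n v, h v = n → Relation.ReflTransGen (G.treeAdj (G.choiceDarts ρ)) v q := by
    intro n
    induction n using Nat.strong_induction_on with
    | _ n ih =>
      rintro v rfl
      by_cases hv : v = q
      · rw [hv]
      · exact .head ⟨ρ ⟨v, hv⟩, G.mem_choiceDarts.2 (.inl ⟨_, rfl⟩), ht _, rfl⟩
          (ih _ (hh ⟨v, hv⟩) _ rfl)
  exact fun u v => (hroot _ u rfl).trans (symm (hroot _ v rfl))

theorem choiceDarts_injOn {q : G.V} {ρ ρ' : {v : G.V // v ≠ q} → G.D}
    (hρ : G.LeadsTo q ρ) (ht : ∀ v, G.tail (ρ v) = v) (ht' : ∀ v, G.tail (ρ' v) = v)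
    (he : G.choiceDarts ρ = G.choiceDarts ρ') : ρ = ρ' := by
  obtain ⟨h, hh⟩ := id hρ
  have key : ∀ n (v : {v : G.V // v ≠ q}), h v = n → ρ v = ρ' v := by
    intro n
    induction n using Nat.strong_induction_on with
    | _ n ih =>
      rintro v rfl
      have hm : ρ v ∈ G.choiceDarts ρ' := he ▸ G.mem_choiceDarts.2 (.inl ⟨v, rfl⟩)
      rcases G.mem_choiceDarts.1 hm with ⟨w, hw⟩ | ⟨w, hw⟩
      · have : w = v := Subtype.ext (by rw [← ht' w, hw, ht])
        rw [← hw, this]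
      · have h1 : G.head (ρ v) = w := by rw [← hw, head_rev, ht']
        have h2 := hh v
        rw [h1] at h2
        rw [← ih _ h2 w rfl] at hw
        exact absurd hw.symm (hρ.ne_rev ht v w)
  exact funext fun v => key _ v rfl

theorem exists_leadsTo_of_reachable (q : G.V) (T : Finset G.D)
    (hT : ∀ v, Relation.ReflTransGen (G.treeAdj T) v q) :
    ∃ ρ : {v : G.V // v ≠ q} → G.D,
      G.LeadsTo q ρ ∧ (∀ v, G.tail (ρ v) = v) ∧ ∀ v, ρ v ∈ T := by
  obtain ⟨h, hh⟩ := exists_height _ q hT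
  have : ∀ v : {v : G.V // v ≠ q}, ∃ d ∈ T, G.tail d = v ∧ h (G.head d) < h v := by
    intro v
    obtain ⟨w, ⟨d, hd, h1, rfl⟩, h2⟩ := hh v v.2
    exact ⟨d, hd, h1, h2⟩
  choose ρ h1 h2 h3 using this
  exact ⟨ρ, ⟨h, h3⟩, h2, h1⟩

theorem exists_choiceDarts_eq (q : G.V) {T : Finset G.D} (hT : G.IsSpanningTree T) :
    ∃ ρ : {v : G.V // v ≠ q} → G.D,
      G.LeadsTo q ρ ∧ (∀ v, G.tail (ρ v) = v) ∧ G.choiceDarts ρ = T := by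
  obtain ⟨hrev, hcon, hcard⟩ := hT
  obtain ⟨ρ, hρ, ht, hmem⟩ := exists_leadsTo_of_reachable q T fun v => hcon v q
  refine ⟨ρ, hρ, ht, Finset.eq_of_subset_of_card_le ?_ ?_⟩
  · intro d hd
    rcases G.mem_choiceDarts.1 hd with ⟨v, rfl⟩ | ⟨v, rfl⟩
    · exact hmem v
    · exact hrev _ (hmem v)
  · rw [hcard, card_choiceDarts hρ ht]

variable (G)

theorem card_isSpanningTree (q : G.V) :
    Nat.card {T : Finset G.D // G.IsSpanningTree T} =
      ((G.dartChoices q).filter fun ρ => G.LeadsTo q ρ).card := by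
  rw [Nat.card_eq_fintype_card, Fintype.card_subtype]
  symm
  refine Finset.card_bij (fun ρ _ => G.choiceDarts ρ) ?_ ?_ ?_
  · intro ρ hρ
    rw [Finset.mem_filter, mem_dartChoices] at hρ
    simpa using isSpanningTree_choiceDarts hρ.2 hρ.1
  · intro ρ hρ ρ' hρ' he
    rw [Finset.mem_filter, mem_dartChoices] at hρ hρ'
    exact choiceDarts_injOn hρ.2 hρ.1 hρ'.1 he
  · intro T hT
    obtain ⟨ρ, h1, h2, h3⟩ := exists_choiceDarts_eq q (Finset.mem_filter.1 hT).2
    exact ⟨ρ, Finset.mem_filter.2 ⟨G.mem_dartChoices.2 h2, h1⟩, h3⟩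

theorem det_reducedLaplacian_ne_zero (hconn : G.Connected) (hloop : G.Loopless) (q : G.V) :
    (G.reducedLaplacian q).det ≠ 0 := by
  obtain ⟨ρ, h1, h2, -⟩ := exists_leadsTo_of_reachable q Finset.univ fun v => by
    refine Relation.ReflTransGen.mono ?_ _ _ (hconn v q)
    rintro a b ⟨d, hd⟩
    exact ⟨d, Finset.mem_univ d, hd⟩
  rw [G.det_reducedLaplacian hloop, Nat.cast_ne_zero, ← Nat.pos_iff_ne_zero, Finset.card_pos]
  exact ⟨ρ, Finset.mem_filter.2 ⟨G.mem_dartChoices.2 h2, h1⟩⟩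

theorem card_Jac_of_isEmpty [IsEmpty G.V] : Nat.card G.Jac = 1 := by
  have : Subsingleton G.Jac := (QuotientAddGroup.mk'_surjective
    (G.Prin.addSubgroupOf G.Div0)).subsingleton
  exact Nat.card_of_subsingleton 0

theorem card_isSpanningTree_of_isEmpty [IsEmpty G.V] :
    Nat.card {T : Finset G.D // G.IsSpanningTree T} = 1 := by
  have : IsEmpty G.D := Function.isEmpty G.head
  have hT : G.IsSpanningTree ∅ := ⟨by simp, fun u => isEmptyElim u, by simp⟩
  exact Nat.card_eq_one_iff_unique.2 ⟨inferInstance, ⟨⟨∅, hT⟩⟩⟩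

end Multigraph

/-- For a finite connected loopless multigraph `G`, the
sandpile group `Jac(G)` is a finite (abelian) group whose order equals the
number of spanning trees of `G`. -/
theorem jac_card_eq_num_spanning_trees (G : Multigraph)
    (hconn : G.Connected) (hloop : G.Loopless) :
    Finite G.Jac ∧
      Nat.card G.Jac = Nat.card {T : Finset G.D // G.IsSpanningTree T} := by
  have hcard : Nat.card G.Jac = Nat.card {T : Finset G.D // G.IsSpanningTree T} ∧
      Nat.card G.Jac ≠ 0 := by
    rcases isEmpty_or_nonempty G.V with hV | ⟨⟨q⟩⟩
    · rw [G.card_Jac_of_isEmpty, G.card_isSpanningTree_of_isEmpty]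
      exact ⟨rfl, one_ne_zero⟩
    · have hdet := G.det_reducedLaplacian_ne_zero hconn hloop q
      rw [G.card_Jac_eq_natAbs_det hloop q hdet]
      refine ⟨?_, Int.natAbs_ne_zero.2 hdet⟩
      rw [G.det_reducedLaplacian hloop, G.card_isSpanningTree q, Int.natAbs_natCast]
  exact ⟨Nat.finite_of_card_ne_zero hcard.2, hcard.1⟩
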